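/- Let V = E₀ ⊕ ⋯ ⊕ E_s be a direct-sum decomposition of V into nonzero subspaces with s ≥ 1 and dim E₀ = 1. Let (B_n)_{n≥1} be invertible linear maps of V and λ₀ > λ₁ > ⋯ > λ_s real numbers such that: (i) for every 0 ≤ k ≤ s and every nonzero x ∈ E_k, (1/n)·log|B_n x| → λ_k as n → ∞; (ii) (1/n)·log κ(B_nE₀, …, B_nE_s) → 0 as n → ∞. Let x̄ ≠ ȳ ∈ P(V) ∖ P(V⁰) and 0 ≤ i < s satisfy g^{i+1}(x̄) ≠ g^{i+1}(ȳ) and gᵏ(x̄) = gᵏ(ȳ) for all 0 ≤ k ≤ i. Then (1/n)·log d(B_n x̄, B_n ȳ) → λ_{i+1} − λ₀ as n → ∞, where B_n x̄ := (B_n x)‾ for any representative x of x̄. -/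

import Mathlib

open scoped RealInnerProductSpace
open Filter

variable {V : Type*} [NormedAddCommGroup V] [InnerProductSpace ℝ V]

/-- The projective distance between the lines spanned by two nonzero vectors:
`d(x̄, ȳ) = (1 − ⟨x,y⟫²/(|x|²|y|²))^{1/2}`. -/
noncomputable def projDist (x y : V) : ℝ :=
  Real.sqrt (1 - ⟪x, y⟫ ^ 2 / (‖x‖ ^ 2 * ‖y‖ ^ 2))

/-- The distance `d(x̄, P(W))` from the line spanned by `x` to the projective space of the
submodule `W`. -/
noncomputable def projDistToSub (x : V) (W : Submodule ℝ V) : ℝ :=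
  sInf {r : ℝ | ∃ y : V, y ∈ W ∧ y ≠ 0 ∧ r = projDist x y}

/-- `κ(E₀,…,E_s)`: the minimal projective distance between nonzero vectors lying in sums of
disjoint subfamilies of the `E i`. -/
noncomputable def kappa {ι : Type*} (E : ι → Submodule ℝ V) : ℝ :=
  sInf {r : ℝ | ∃ (I J : Finset ι) (x y : V), I.Nonempty ∧ J.Nonempty ∧ Disjoint I J ∧
    x ∈ (⨆ i ∈ I, E i) ∧ x ≠ 0 ∧ y ∈ (⨆ j ∈ J, E j) ∧ y ≠ 0 ∧ r = projDist x y}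

/-- `Vⁱ = E_{i+1} ⊕ ⋯ ⊕ E_s`. -/
noncomputable def Vlow {s : ℕ} (E : Fin (s+1) → Submodule ℝ V) (i : ℕ) : Submodule ℝ V :=
  ⨆ j : Fin (s+1), ⨆ _ : i < (j : ℕ), E j

/-- `Wⁱ = E₀ ⊕ ⋯ ⊕ E_i`. -/
noncomputable def Whigh {s : ℕ} (E : Fin (s+1) → Submodule ℝ V) (i : ℕ) : Submodule ℝ V :=
  ⨆ j : Fin (s+1), ⨆ _ : (j : ℕ) ≤ i, E j

/-- `‖x ∧ y‖ = (|x|²|y|² − ⟨x,y⟫²)^{1/2}`, the area of the parallelogram spanned by `x, y`. -/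
noncomputable def wedgeNorm (x y : V) : ℝ :=
  Real.sqrt (‖x‖ ^ 2 * ‖y‖ ^ 2 - ⟪x, y⟫ ^ 2)

lemma projDist_nonneg' (a b : V) : 0 ≤ projDist a b := Real.sqrt_nonneg _

lemma projDist_le_one' (a b : V) : projDist a b ≤ 1 := by
  unfold projDist
  rw [Real.sqrt_le_left zero_le_one, one_pow]
  have : 0 ≤ ⟪a, b⟫ ^ 2 / (‖a‖ ^ 2 * ‖b‖ ^ 2) := by positivity
  linarith

lemma projDist_sq (a b : V) : projDist a b ^ 2 = 1 - ⟪a, b⟫ ^ 2 / (‖a‖ ^ 2 * ‖b‖ ^ 2) := by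
  unfold projDist
  rw [Real.sq_sqrt]
  have h : ⟪a, b⟫ ^ 2 ≤ ‖a‖ ^ 2 * ‖b‖ ^ 2 := by
    rw [← mul_pow]
    exact sq_le_sq' (by linarith [neg_le_of_abs_le (abs_real_inner_le_norm a b)])
      (real_inner_le_norm a b)
  have := div_le_one_of_le₀ h (by positivity)
  linarith

lemma norm_sub_smul_sq (a b : V) (c : ℝ) :
    ‖a - c • b‖ ^ 2 = ‖a‖ ^ 2 - 2 * c * ⟪a, b⟫ + c ^ 2 * ‖b‖ ^ 2 := by
  rw [norm_sub_sq_real, inner_smul_right, norm_smul, mul_pow, Real.norm_eq_abs, sq_abs]; ring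

lemma projDist_mul_le (a b : V) (ha : a ≠ 0) (hb : b ≠ 0) (c : ℝ) :
    projDist a b * ‖a‖ ≤ ‖a - c • b‖ := by
  have ha' := norm_pos_iff.2 ha
  have hb' := norm_pos_iff.2 hb
  refine abs_le_of_sq_le_sq ?_ (norm_nonneg _) |> le_of_abs_le
  rw [mul_pow, projDist_sq, norm_sub_smul_sq]
  have : (1 - ⟪a, b⟫ ^ 2 / (‖a‖ ^ 2 * ‖b‖ ^ 2)) * ‖a‖ ^ 2
      = ‖a‖ ^ 2 - 2 * c * ⟪a, b⟫ + c ^ 2 * ‖b‖ ^ 2 - (c * ‖b‖ - ⟪a, b⟫ / ‖b‖) ^ 2 := by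
    field_simp; ring
  rw [this]
  nlinarith [sq_nonneg (c * ‖b‖ - ⟪a, b⟫ / ‖b‖)]

lemma projDist_mul_eq (a b : V) (ha : a ≠ 0) (hb : b ≠ 0) :
    ∃ c : ℝ, projDist a b * ‖a‖ = ‖a - c • b‖ := by
  have ha' := norm_pos_iff.2 ha
  have hb' := norm_pos_iff.2 hb
  refine ⟨⟪a, b⟫ / ‖b‖ ^ 2, ?_⟩
  rw [← sq_eq_sq₀ (mul_nonneg (projDist_nonneg' _ _) (norm_nonneg _)) (norm_nonneg _),
    mul_pow, projDist_sq, norm_sub_smul_sq]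
  field_simp; ring

lemma projDist_smul' (a b : V) (c d : ℝ) (hc : c ≠ 0) (hd : d ≠ 0) :
    projDist (c • a) (d • b) = projDist a b := by
  unfold projDist
  congr 2
  rw [inner_smul_left, inner_smul_right, norm_smul, norm_smul]
  simp only [mul_pow, Real.norm_eq_abs, sq_abs, conj_trivial]
  rw [show c ^ 2 * (d ^ 2 * ⟪a, b⟫ ^ 2) = (c ^ 2 * d ^ 2) * ⟪a, b⟫ ^ 2 by ring,
    show c ^ 2 * ‖a‖ ^ 2 * (d ^ 2 * ‖b‖ ^ 2) = (c ^ 2 * d ^ 2) * (‖a‖ ^ 2 * ‖b‖ ^ 2) by ring,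
    mul_div_mul_left _ _ (by positivity)]

lemma projDist_comm' (a b : V) : projDist a b = projDist b a := by
  unfold projDist
  rw [real_inner_comm, mul_comm]

lemma kappa_le {ι : Type*} (F : ι → Submodule ℝ V) (I J : Finset ι) (hIJ : Disjoint I J)
    (hI : I.Nonempty) (hJ : J.Nonempty) (x y : V)
    (hx : x ∈ (⨆ i ∈ I, F i)) (hy : y ∈ (⨆ i ∈ J, F i)) (hx0 : x ≠ 0) (hy0 : y ≠ 0) :
    kappa F ≤ projDist x y := by
  refine csInf_le ⟨0, ?_⟩ ⟨I, J, x, y, hI, hJ, hIJ, hx, hx0, hy, hy0, rfl⟩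
  rintro r ⟨_, _, x, y, _, _, _, _, _, _, _, rfl⟩
  exact projDist_nonneg' _ _

/-- Upper exponential bound. -/
def UB (a : ℕ → ℝ) (l : ℝ) : Prop := ∀ ε > 0, ∀ᶠ n : ℕ in atTop, a n ≤ Real.exp (n * (l + ε))
/-- Lower exponential bound. -/
def LB (a : ℕ → ℝ) (l : ℝ) : Prop := ∀ ε > 0, ∀ᶠ n : ℕ in atTop, Real.exp (n * (l - ε)) ≤ a n

lemma UB.of_tendsto {a : ℕ → ℝ} {l : ℝ} (ha : ∀ n, 0 < a n)
    (h : Tendsto (fun n : ℕ => (n : ℝ)⁻¹ * Real.log (a n)) atTop (nhds l)) : UB a l := by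
  intro ε hε
  filter_upwards [h.eventually (gt_mem_nhds (show l < l + ε by linarith)), eventually_gt_atTop 0]
    with n h1 h2
  have hn : (0 : ℝ) < n := by exact_mod_cast h2
  rw [← Real.log_le_iff_le_exp (ha n)]
  rw [inv_mul_lt_iff₀ hn] at h1
  exact h1.le

lemma LB.of_tendsto {a : ℕ → ℝ} {l : ℝ} (ha : ∀ n, 0 < a n)
    (h : Tendsto (fun n : ℕ => (n : ℝ)⁻¹ * Real.log (a n)) atTop (nhds l)) : LB a l := by
  intro ε hε
  filter_upwards [h.eventually (lt_mem_nhds (show l - ε < l by linarith)), eventually_gt_atTop 0]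
    with n h1 h2
  have hn : (0 : ℝ) < n := by exact_mod_cast h2
  rw [← Real.le_log_iff_exp_le (ha n)]
  rw [lt_inv_mul_iff₀ hn] at h1
  exact h1.le

lemma tendsto_of_UB_LB {a : ℕ → ℝ} {l : ℝ} (h1 : UB a l) (h2 : LB a l) :
    Tendsto (fun n : ℕ => (n : ℝ)⁻¹ * Real.log (a n)) atTop (nhds l) := by
  rw [Metric.tendsto_nhds]
  intro ε hε
  filter_upwards [h1 (ε / 2) (by linarith), h2 (ε / 2) (by linarith), eventually_gt_atTop 0]
    with n h1 h2 h3
  have hn : (0 : ℝ) < n := by exact_mod_cast h3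
  have ha : 0 < a n := (Real.exp_pos _).trans_le h2
  rw [← Real.log_le_iff_le_exp ha] at h1
  rw [← Real.le_log_iff_exp_le ha] at h2
  rw [← inv_mul_le_iff₀ hn] at h1
  rw [← le_inv_mul_iff₀ hn] at h2
  rw [Real.dist_eq, abs_lt]
  constructor <;> linarith

lemma UB.mono {a b : ℕ → ℝ} {l m : ℝ} (h : UB a l) (hb : ∀ n, b n ≤ a n) (hl : l ≤ m) :
    UB b m := by
  intro ε hε
  filter_upwards [h ε hε] with n hn
  refine (hb n).trans (hn.trans ?_)
  gcongr

lemma LB.mono {a b : ℕ → ℝ} {l : ℝ} (h : LB a l) (hb : ∀ n, a n ≤ b n) : LB b l := by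
  intro ε hε
  filter_upwards [h ε hε] with n hn
  exact hn.trans (hb n)

lemma UB.mul {a b : ℕ → ℝ} {l m : ℝ} (ha : UB a l) (hb : UB b m) (hb0 : ∀ n, 0 ≤ b n) :
    UB (fun n => a n * b n) (l + m) := by
  intro ε hε
  filter_upwards [ha (ε / 2) (by linarith), hb (ε / 2) (by linarith)] with n h1 h2
  refine (mul_le_mul h1 h2 (hb0 n) (Real.exp_pos _).le).trans ?_
  rw [← Real.exp_add]
  apply le_of_eq; ring_nf

lemma LB.mul {a b : ℕ → ℝ} {l m : ℝ} (ha : LB a l) (hb : LB b m) (ha0 : ∀ n, 0 ≤ a n) :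
    LB (fun n => a n * b n) (l + m) := by
  intro ε hε
  filter_upwards [ha (ε / 2) (by linarith), hb (ε / 2) (by linarith)] with n h1 h2
  refine le_trans ?_ (mul_le_mul h1 h2 (Real.exp_pos _).le (ha0 n))
  rw [← Real.exp_add]
  apply le_of_eq; ring_nf

lemma LB.inv {a : ℕ → ℝ} {l : ℝ} (ha : LB a l) : UB (fun n => (a n)⁻¹) (-l) := by
  intro ε hε
  filter_upwards [ha ε hε] with n h
  rw [show (n : ℝ) * (-l + ε) = -(n * (l - ε)) by ring, Real.exp_neg]
  exact inv_anti₀ (Real.exp_pos _) h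

lemma UB.inv {a : ℕ → ℝ} {l : ℝ} (ha : UB a l) (h0 : ∀ n, 0 < a n) :
    LB (fun n => (a n)⁻¹) (-l) := by
  intro ε hε
  filter_upwards [ha ε hε] with n h
  rw [show (n : ℝ) * (-l - ε) = -(n * (l + ε)) by ring, Real.exp_neg]
  exact inv_anti₀ (h0 n) h

lemma UB.add {a b : ℕ → ℝ} {l : ℝ} (ha : UB a l) (hb : UB b l) :
    UB (fun n => a n + b n) l := by
  intro ε hε
  have ht : Tendsto (fun n : ℕ => (n : ℝ) * (ε / 2)) atTop atTop :=
    tendsto_natCast_atTop_atTop.atTop_mul_const (by linarith)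
  filter_upwards [ha (ε / 2) (by linarith), hb (ε / 2) (by linarith),
    ht.eventually_ge_atTop 1] with n h1 h2 h3
  have h4 : Real.exp (n * (l + ε)) = Real.exp (n * (ε / 2)) * Real.exp (n * (l + ε / 2)) := by
    rw [← Real.exp_add]; ring_nf
  have h5 := Real.add_one_le_exp ((n : ℝ) * (ε / 2))
  rw [h4]
  nlinarith [Real.exp_pos (n * (l + ε / 2))]

lemma UB.zero (l : ℝ) : UB (fun _ => 0) l :=
  fun _ _ => Eventually.of_forall fun _ => (Real.exp_pos _).le

lemma UB.sum {ι : Type*} (S : Finset ι) {a : ι → ℕ → ℝ} {l : ℝ} (h : ∀ k ∈ S, UB (a k) l) :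
    UB (fun n => ∑ k ∈ S, a k n) l := by
  classical
  induction S using Finset.induction_on with
  | empty => simpa using UB.zero l
  | insert k S hk ih =>
    simp only [Finset.sum_insert hk]
    exact (h k (by simp)).add (ih fun j hj => h j (by simp [hj]))

section
variable {s : ℕ} {E : Fin (s+1) → Submodule ℝ V} {L : Fin (s+1) → V →ₗ[ℝ] V}

lemma L_zero (hE : DirectSum.IsInternal E) (hL1 : ∀ x : V, ∑ k, L k x = x)
    (hL2 : ∀ k x, L k x ∈ E k) {k j : Fin (s+1)} (hjk : k ≠ j) {x : V} (hx : x ∈ E k) :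
    L j x = 0 := by
  have hd := hE.submodule_iSupIndep j
  rw [Submodule.disjoint_def] at hd
  refine hd _ (hL2 j x) ?_
  have h1 : L j x = x - ∑ l ∈ Finset.univ.erase j, L l x := by
    rw [eq_sub_iff_add_eq, Finset.add_sum_erase _ (fun l => L l x) (Finset.mem_univ j), hL1]
  rw [h1]
  refine Submodule.sub_mem _ (Submodule.mem_iSup_of_mem k (Submodule.mem_iSup_of_mem hjk hx)) ?_
  refine Submodule.sum_mem _ fun l hl => ?_
  exact Submodule.mem_iSup_of_mem l (Submodule.mem_iSup_of_mem (Finset.ne_of_mem_erase hl) (hL2 l x))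

lemma L_self (hE : DirectSum.IsInternal E) (hL1 : ∀ x : V, ∑ k, L k x = x)
    (hL2 : ∀ k x, L k x ∈ E k) {k : Fin (s+1)} {x : V} (hx : x ∈ E k) : L k x = x := by
  conv_rhs => rw [← hL1 x]
  rw [Finset.sum_eq_single k (fun j _ hj => L_zero hE hL1 hL2 hj.symm hx) (by simp)]

lemma kappa_pos [FiniteDimensional ℝ V] (hE : DirectSum.IsInternal E)
    (hL1 : ∀ x : V, ∑ k, L k x = x)
    (hL2 : ∀ k x, L k x ∈ E k) (hs : 1 ≤ s) (hEne : ∀ k, E k ≠ ⊥) (B : V ≃ₗ[ℝ] V) :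
    0 < kappa (fun k => (E k).map (B : V →ₗ[ℝ] V)) := by
  classical
  let P : Finset (Fin (s+1)) → V →L[ℝ] V := fun I =>
    LinearMap.toContinuousLinearMap
      ((B : V →ₗ[ℝ] V) ∘ₗ (∑ k ∈ I, L k) ∘ₗ (B.symm : V →ₗ[ℝ] V))
  have hP : ∀ I z, P I z = B (∑ k ∈ I, L k (B.symm z)) := by
    intro I z; simp [P]
  have hP1 : ∀ I, ∀ z ∈ (⨆ i ∈ I, (E i).map (B : V →ₗ[ℝ] V)), P I z = z := by
    intro I z hz
    have : (⨆ i ∈ I, (E i).map (B : V →ₗ[ℝ] V)) ≤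
        LinearMap.eqLocus (P I : V →ₗ[ℝ] V) LinearMap.id := by
      refine iSup₂_le fun i hi => ?_
      rintro _ ⟨w, hw, rfl⟩
      simp only [LinearMap.mem_eqLocus, LinearMap.id_apply]
      change P I (B w) = B w
      rw [hP, B.symm_apply_apply, Finset.sum_eq_single i
        (fun j _ hj => L_zero hE hL1 hL2 hj.symm hw) (fun h => absurd hi h),
        L_self hE hL1 hL2 hw]
    exact this hz
  have hP0 : ∀ I J, Disjoint I J → ∀ z ∈ (⨆ i ∈ J, (E i).map (B : V →ₗ[ℝ] V)), P I z = 0 := by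
    intro I J hIJ z hz
    have : (⨆ i ∈ J, (E i).map (B : V →ₗ[ℝ] V)) ≤ LinearMap.ker (P I : V →ₗ[ℝ] V) := by
      refine iSup₂_le fun i hi => ?_
      rintro _ ⟨w, hw, rfl⟩
      rw [LinearMap.mem_ker]
      change P I (B w) = 0
      rw [hP, B.symm_apply_apply, Finset.sum_eq_zero, map_zero]
      intro j hj
      refine L_zero hE hL1 hL2 ?_ hw
      rintro rfl
      exact Finset.disjoint_left.1 hIJ hj hi
    exact this hz
  let C : ℝ := 1 + ∑ I : Finset (Fin (s+1)), ‖P I‖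
  have hC : 0 < C := by
    have : 0 ≤ ∑ I : Finset (Fin (s+1)), ‖P I‖ := Finset.sum_nonneg fun _ _ => norm_nonneg _
    positivity
  have hCP : ∀ I, ‖P I‖ ≤ C := by
    intro I
    have := Finset.single_le_sum (f := fun I => ‖P I‖) (fun _ _ => norm_nonneg _)
      (Finset.mem_univ I)
    simp only [C]; linarith
  refine (inv_pos.2 hC).trans_le (le_csInf ?_ ?_)
  · obtain ⟨a, ha, ha0⟩ := Submodule.exists_mem_ne_zero_of_ne_bot (hEne 0)
    obtain ⟨b, hb, hb0⟩ := Submodule.exists_mem_ne_zero_of_ne_bot (hEne (Fin.last s))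
    refine ⟨_, {0}, {Fin.last s}, B a, B b, by simp, by simp, ?_, ?_, by simpa using ha0, ?_,
      by simpa using hb0, rfl⟩
    · rw [Finset.disjoint_singleton]
      intro h
      have := congrArg Fin.val h
      simp at this; omega
    · simpa using ha
    · simpa using hb
  · rintro r ⟨I, J, x, y, hI, hJ, hIJ, hx, hx0, hy, hy0, rfl⟩
    obtain ⟨c, hc⟩ := projDist_mul_eq x y hx0 hy0
    have h1 : P I (x - c • y) = x := by
      rw [map_sub, map_smul, hP1 I x hx, hP0 I J hIJ y hy]; simp
    have h2 : ‖x‖ ≤ C * ‖x - c • y‖ := by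
      conv_lhs => rw [← h1]
      exact ((P I).le_opNorm _).trans (mul_le_mul_of_nonneg_right (hCP I) (norm_nonneg _))
    rw [← hc] at h2
    have hx' := norm_pos_iff.2 hx0
    rw [inv_le_iff_one_le_mul₀' hC]
    nlinarith

lemma kappa_le_one (hs : 1 ≤ s) (hEne : ∀ k, E k ≠ ⊥) (B : V ≃ₗ[ℝ] V) :
    kappa (fun k => (E k).map (B : V →ₗ[ℝ] V)) ≤ 1 := by
  obtain ⟨a, ha, ha0⟩ := Submodule.exists_mem_ne_zero_of_ne_bot (hEne 0)
  obtain ⟨b, hb, hb0⟩ := Submodule.exists_mem_ne_zero_of_ne_bot (hEne (Fin.last s))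
  refine (kappa_le _ {0} {Fin.last s} ?_ (by simp) (by simp) (B a) (B b) ?_ ?_
    (by simpa using ha0) (by simpa using hb0)).trans (projDist_le_one' _ _)
  · rw [Finset.disjoint_singleton]
    intro h
    have := congrArg Fin.val h
    simp at this; omega
  · simpa using ha
  · simpa using hb

lemma kappa_mul_le (hL1 : ∀ x : V, ∑ k, L k x = x)
    (hL2 : ∀ k x, L k x ∈ E k) (hs : 1 ≤ s) (hEne : ∀ k, E k ≠ ⊥) (B : V ≃ₗ[ℝ] V)
    (j : Fin (s+1)) (z : V) :
    kappa (fun k => (E k).map (B : V →ₗ[ℝ] V)) * ‖B (L j z)‖ ≤ ‖B z‖ := by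
  classical
  by_cases ha : L j z = 0
  · simp [ha]
  set b := ∑ k ∈ Finset.univ.erase j, L k z with hb
  have hz : z = L j z + b := by
    rw [hb, Finset.add_sum_erase _ (fun l => L l z) (Finset.mem_univ j), hL1]
  by_cases hb0 : b = 0
  · rw [hb0, add_zero] at hz
    rw [← hz]
    exact mul_le_of_le_one_left (norm_nonneg _) (kappa_le_one hs hEne B)
  have hne : (Finset.univ.erase j).Nonempty := by
    by_contra h
    rw [Finset.not_nonempty_iff_eq_empty] at h
    exact hb0 (by rw [hb, h]; simp)
  have hBa : B (L j z) ≠ 0 := by simpa using ha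
  have hBb : B b ≠ 0 := by simpa using hb0
  have h1 := kappa_le (fun k => (E k).map (B : V →ₗ[ℝ] V)) {j} (Finset.univ.erase j)
    (by simp) (by simp) hne (B (L j z)) (B b)
    (by simpa using hL2 j z)
    (by
      rw [hb, map_sum]
      refine Submodule.sum_mem _ fun k hk => ?_
      exact Submodule.mem_iSup_of_mem k (Submodule.mem_iSup_of_mem hk
        (Submodule.mem_map_of_mem (hL2 k z))))
    hBa hBb
  have h2 := projDist_mul_le (B (L j z)) (B b) hBa hBb (-1)
  have h3 : B (L j z) - (-1 : ℝ) • B b = B z := by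
    conv_rhs => rw [hz, map_add]
    simp
  rw [h3] at h2
  exact (mul_le_mul_of_nonneg_right h1 (norm_nonneg _)).trans h2

end

/-- Lemma 3.3 of the paper. Given an Oseledets-type splitting
`V = E₀ ⊕ ⋯ ⊕ E_s` with `dim E₀ = 1`, invertible maps `Bₙ` with asymptotic growth rates
`λ₀ > ⋯ > λ_s` on the pieces and subexponential decay of the angles `κ(BₙE₀,…,BₙE_s)`,
if `x̄ ≠ ȳ ∈ P(V) ∖ P(V⁰)` agree in the coordinates `g⁰,…,gⁱ` but not in `g^{i+1}`, then
`(1/n)·log d(Bₙx̄, Bₙȳ) → λ_{i+1} − λ₀`. -/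
theorem stmt4 [FiniteDimensional ℝ V] (hdim : 2 ≤ Module.finrank ℝ V)
    (s : ℕ) (hs : 1 ≤ s) (E : Fin (s+1) → Submodule ℝ V)
    (hE : DirectSum.IsInternal E) (hEne : ∀ k, E k ≠ ⊥)
    (hE0 : Module.finrank ℝ (E 0) = 1)
    (L : Fin (s+1) → V →ₗ[ℝ] V)
    (hL1 : ∀ x : V, ∑ k, L k x = x) (hL2 : ∀ k x, L k x ∈ E k)
    (u₀ : V) (hu₀ : u₀ ∈ E 0) (hu₀n : ‖u₀‖ = 1)
    (f₀ : V →ₗ[ℝ] ℝ) (hf₀ : ∀ x, L 0 x = f₀ x • u₀)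
    (B : ℕ → V ≃ₗ[ℝ] V) (lam : Fin (s+1) → ℝ)
    (hlam : ∀ k l : Fin (s+1), k < l → lam l < lam k)
    (hgrowth : ∀ k : Fin (s+1), ∀ x ∈ E k, x ≠ 0 →
      Tendsto (fun n : ℕ => (n : ℝ)⁻¹ * Real.log ‖B n x‖) atTop (nhds (lam k)))
    (hkappa : Tendsto (fun n : ℕ =>
        (n : ℝ)⁻¹ * Real.log (kappa fun k => (E k).map ((B n : V →ₗ[ℝ] V))))
      atTop (nhds 0))
    (x y : V) (hx : x ≠ 0) (hy : y ≠ 0) (hxy : ∀ c : ℝ, y ≠ c • x)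
    (hfx : f₀ x ≠ 0) (hfy : f₀ y ≠ 0)
    (i : ℕ) (hi : i < s)
    (hgi : (f₀ x)⁻¹ • L ⟨i+1, by omega⟩ x ≠ (f₀ y)⁻¹ • L ⟨i+1, by omega⟩ y)
    (hgk : ∀ k : Fin (s+1), (k : ℕ) ≤ i → (f₀ x)⁻¹ • L k x = (f₀ y)⁻¹ • L k y) :
    Tendsto (fun n : ℕ => (n : ℝ)⁻¹ * Real.log (projDist (B n x) (B n y)))
      atTop (nhds (lam ⟨i+1, by omega⟩ - lam 0)) := by
  have hBpos : ∀ z : V, z ≠ 0 → ∀ n, 0 < ‖B n z‖ := fun z hz n => by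
    rw [norm_pos_iff]; simpa using hz
  have hkp := fun n => kappa_pos hE hL1 hL2 hs hEne (B n)
  have hkLB : LB (fun n => kappa fun k => (E k).map ((B n : V →ₗ[ℝ] V))) 0 :=
    LB.of_tendsto hkp hkappa
  have hlead : ∀ (z : V) (j : Fin (s+1)), (∀ k < j, L k z = 0) → L j z ≠ 0 →
      UB (fun n => ‖B n z‖) (lam j) ∧ LB (fun n => ‖B n z‖) (lam j) := by
    intro z j hz hj
    constructor
    · have h1 : UB (fun n => ∑ k, ‖B n (L k z)‖) (lam j) := by
        refine UB.sum _ fun k _ => ?_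
        by_cases hk : L k z = 0
        · simpa [hk] using UB.zero (lam j)
        · have hjk : j ≤ k := by
            by_contra h
            exact hk (hz k (not_le.1 h))
          refine (UB.of_tendsto (hBpos _ hk) (hgrowth k _ (hL2 k z) hk)).mono
            (fun _ => le_rfl) ?_
          rcases hjk.eq_or_lt with h | h
          · rw [h]
          · exact (hlam _ _ h).le
      refine h1.mono (fun n => ?_) le_rfl
      conv_lhs => rw [← hL1 z, map_sum]
      exact norm_sum_le _ _
    · have h1 := hkLB.mul (LB.of_tendsto (hBpos _ hj) (hgrowth j _ (hL2 j z) hj))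
        (fun n => (hkp n).le)
      rw [zero_add] at h1
      exact h1.mono fun n => kappa_mul_le hL1 hL2 hs hEne (B n) j z
  have hu0 : u₀ ≠ 0 := by
    intro h; rw [h, norm_zero] at hu₀n; exact zero_ne_one hu₀n
  set j : Fin (s+1) := ⟨i+1, by omega⟩ with hj
  set x' := (f₀ x)⁻¹ • x with hx'
  set y' := (f₀ y)⁻¹ • y with hy'
  set w := y' - x' with hw
  have hLx0 : L 0 x' = u₀ := by
    rw [hx', map_smul, hf₀, smul_smul, inv_mul_cancel₀ hfx, one_smul]
  have hLy0 : L 0 y' = u₀ := by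
    rw [hy', map_smul, hf₀, smul_smul, inv_mul_cancel₀ hfy, one_smul]
  have hx'0 : x' ≠ 0 := smul_ne_zero (inv_ne_zero hfx) hx
  have hy'0 : y' ≠ 0 := smul_ne_zero (inv_ne_zero hfy) hy
  have hLw : ∀ k < j, L k w = 0 := by
    intro k hk
    rw [hw, map_sub, hx', hy', map_smul, map_smul, sub_eq_zero]
    refine (hgk k ?_).symm
    have : (k : ℕ) < i + 1 := hk
    omega
  have hLwj : L j w ≠ 0 := by
    rw [hw, map_sub, hx', hy', map_smul, map_smul, sub_ne_zero]
    exact hgi.symm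
  have hw0 : w ≠ 0 := by
    intro h; rw [h, map_zero] at hLwj; exact hLwj rfl
  obtain ⟨hxU, hxL⟩ := hlead x' 0 (fun k hk => absurd hk (Fin.not_lt_zero k)) (by rwa [hLx0])
  obtain ⟨hyU, hyL⟩ := hlead y' 0 (fun k hk => absurd hk (Fin.not_lt_zero k)) (by rwa [hLy0])
  obtain ⟨hwU, hwL⟩ := hlead w j hLw hLwj
  have huL := LB.of_tendsto (hBpos _ hu0) (hgrowth 0 u₀ hu₀ hu0)
  have hd : ∀ n, projDist (B n x) (B n y) = projDist (B n y') (B n x') := by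
    intro n
    rw [hx', hy', map_smul, map_smul, projDist_smul' _ _ _ _ (inv_ne_zero hfy) (inv_ne_zero hfx),
      projDist_comm']
  simp only [hd]
  have hne : ∀ n z, z ≠ 0 → B n z ≠ 0 := fun n z hz => by simpa using hz
  apply tendsto_of_UB_LB
  · have h1 := hwU.mul hyL.inv (fun n => inv_nonneg.2 (norm_nonneg _))
    rw [← sub_eq_add_neg] at h1
    refine h1.mono (fun n => ?_) le_rfl
    rw [← div_eq_mul_inv, le_div_iff₀ (hBpos _ hy'0 n)]
    refine (projDist_mul_le _ _ (hne n _ hy'0) (hne n _ hx'0) 1).trans (le_of_eq ?_)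
    rw [one_smul, ← map_sub]
  · have h1 : UB (fun _ => (1 : ℝ)) 0 := by
      intro ε hε
      refine Eventually.of_forall fun n => ?_
      rw [zero_add]
      exact Real.one_le_exp (by positivity)
    have h2 := hxU.mul (hkLB.mul huL (fun n => (hkp n).le)).inv
      (fun n => inv_nonneg.2 (mul_nonneg (hkp n).le (norm_nonneg _)))
    rw [zero_add, add_neg_cancel] at h2
    have hq : ∀ n, 0 ≤ ‖B n x'‖ * ((kappa fun k => (E k).map ((B n : V →ₗ[ℝ] V)))
        * ‖B n u₀‖)⁻¹ := fun n =>
      mul_nonneg (norm_nonneg _) (inv_nonneg.2 (mul_nonneg (hkp n).le (norm_nonneg _)))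
    have h3 := (h1.add h2).inv (fun n => by linarith [hq n])
    have h4 := (hwL.mul (hyU.inv (hBpos _ hy'0)) (fun n => norm_nonneg _)).mul h3
      (fun n => mul_nonneg (norm_nonneg _) (inv_nonneg.2 (norm_nonneg _)))
    rw [neg_zero, add_zero, ← sub_eq_add_neg] at h4
    refine h4.mono fun n => ?_
    obtain ⟨c, hc⟩ := projDist_mul_eq _ _ (hne n _ hy'0) (hne n _ hx'0)
    have e1 : B n y' - c • B n x' = B n (w - (c - 1) • x') := by
      rw [← map_smul, ← map_sub]; congr 1; rw [hw]; module
    rw [e1] at hc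
    have e2 := kappa_mul_le hL1 hL2 hs hEne (B n) 0 (w - (c - 1) • x')
    have e3 : L 0 (w - (c - 1) • x') = -((c - 1) • u₀) := by
      rw [map_sub, map_smul, hLx0, hLw 0 (by rw [hj, Fin.lt_def]; simp), zero_sub]
    rw [e3, map_neg, norm_neg, map_smul, norm_smul] at e2
    have e4 : ‖B n w‖ ≤ ‖B n (w - (c - 1) • x')‖ + ‖c - 1‖ * ‖B n x'‖ := by
      have : B n w = B n (w - (c - 1) • x') + (c - 1) • B n x' := by
        rw [← map_smul, ← map_add]; congr 1; module
      rw [← norm_smul]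
      conv_lhs => rw [this]
      exact norm_add_le _ _
    set δ := ‖B n (w - (c - 1) • x')‖ with hδ
    have hK := mul_pos (hkp n) (hBpos _ hu0 n)
    set K := kappa fun k => (E k).map ((B n : V →ₗ[ℝ] V))
    have e5 : ‖c - 1‖ ≤ δ * (K * ‖B n u₀‖)⁻¹ := by
      rw [← div_eq_mul_inv, le_div_iff₀ hK]; linarith
    have e6 := mul_le_mul_of_nonneg_right e5 (norm_nonneg (B n x'))
    have hQ := hq n
    rw [← div_eq_mul_inv, ← div_eq_mul_inv, div_div, div_le_iff₀
      (mul_pos (hBpos _ hy'0 n) (by linarith)), ← mul_assoc, hc]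
    linarith
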